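/- arXiv:math/0701922 — 14 statements merged into one kernel-verified Lean document; each statement's English description precedes it below -/
import Mathlib

section
/- Let P be a Borel probability measure on ℝ. Then the median set {m ∈ ℝ : P((−∞,m]) ≥ 1/2 and P([m,∞)) ≥ 1/2} is equal to the intersection of all closed (possibly unbounded) intervals J ⊆ ℝ with P(J) > 1/2; in particular this intersection is a nonempty compact interval. -/
open MeasureTheory Set

/-- A closed (possibly unbounded) interval in ℝ: `[a,b]`, `(-∞,b]`, `[a,∞)`, or ℝ itself. -/
def IsClosedIntervalR (J : Set ℝ) : Prop :=
  (∃ a b : ℝ, J = Set.Icc a b) ∨ (∃ b : ℝ, J = Set.Iic b) ∨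
    (∃ a : ℝ, J = Set.Ici a) ∨ J = Set.univ

/-- The median set of a Borel probability measure on ℝ. -/
def medianSet (P : Measure ℝ) : Set ℝ :=
  {m : ℝ | 1/2 ≤ P (Set.Iic m) ∧ 1/2 ≤ P (Set.Ici m)}

theorem IsClosedIntervalR.ordConnected {J : Set ℝ} (hJ : IsClosedIntervalR J) :
    J.OrdConnected := by
  rcases hJ with ⟨a, b, rfl⟩ | ⟨b, rfl⟩ | ⟨a, rfl⟩ | rfl
  exacts [ordConnected_Icc, ordConnected_Iic, ordConnected_Ici, ordConnected_univ]

theorem IsClosedIntervalR.isClosed {J : Set ℝ} (hJ : IsClosedIntervalR J) : IsClosed J := by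
  rcases hJ with ⟨a, b, rfl⟩ | ⟨b, rfl⟩ | ⟨a, rfl⟩ | rfl
  exacts [isClosed_Icc, isClosed_Iic, isClosed_Ici, isClosed_univ]

theorem isClosedIntervalR_Icc (a b : ℝ) : IsClosedIntervalR (Icc a b) :=
  Or.inl ⟨a, b, rfl⟩

theorem half_lt_measure_compl_iff (P : Measure ℝ) [IsProbabilityMeasure P] {s : Set ℝ}
    (hs : MeasurableSet s) : 1 / 2 < P sᶜ ↔ P s < 1 / 2 := by
  rw [prob_compl_eq_one_sub hs, lt_tsub_iff_left]
  nth_rewrite 2 [← ENNReal.add_halves 1]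
  exact ENNReal.add_lt_add_iff_right (by simp)

theorem half_lt_measure_Ioi_iff (P : Measure ℝ) [IsProbabilityMeasure P] (m : ℝ) :
    1 / 2 < P (Ioi m) ↔ P (Iic m) < 1 / 2 := by
  rw [← half_lt_measure_compl_iff P measurableSet_Iic, compl_Iic]

theorem half_lt_measure_Iio_iff (P : Measure ℝ) [IsProbabilityMeasure P] (m : ℝ) :
    1 / 2 < P (Iio m) ↔ P (Ici m) < 1 / 2 := by
  rw [← half_lt_measure_compl_iff P measurableSet_Ici, compl_Ici]

theorem exists_Icc_subset_lt_measure (P : Measure ℝ) [IsFiniteMeasure P] {U : Set ℝ}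
    (hU : IsOpen U) (hconn : U.OrdConnected) {r : ENNReal} (hr : r < P U) :
    ∃ a b : ℝ, a ≤ b ∧ Icc a b ⊆ U ∧ r < P (Icc a b) := by
  obtain ⟨K, hKU, hK, hrK⟩ := hU.exists_lt_isCompact hr
  have hne : K.Nonempty := nonempty_of_measure_ne_zero (ne_bot_of_gt hrK)
  exact ⟨sInf K, sSup K, csInf_le_csSup hne hK.bddBelow hK.bddAbove,
    hconn.out (hKU (hK.sInf_mem hne)) (hKU (hK.sSup_mem hne)),
    hrK.trans_le (measure_mono (subset_Icc_csInf_csSup hK.bddBelow hK.bddAbove))⟩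

theorem medianSet_eq_sInter (P : Measure ℝ) [IsProbabilityMeasure P] :
    medianSet P = ⋂₀ {J : Set ℝ | IsClosedIntervalR J ∧ 1 / 2 < P J} := by
  ext m
  constructor
  · rintro ⟨hl, hr⟩ J ⟨hJ, hPJ⟩
    by_contra hm
    have hside : J ⊆ Ioi m ∨ J ⊆ Iio m := by
      by_contra! h
      obtain ⟨⟨x, hx, hxm⟩, y, hy, hym⟩ := And.imp not_subset.1 not_subset.1 h
      exact hm (hJ.ordConnected.out hx hy ⟨not_lt.1 hxm, not_lt.1 hym⟩)
    rcases hside with h | h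
    · exact hl.not_gt ((half_lt_measure_Ioi_iff P m).1 (hPJ.trans_le (measure_mono h)))
    · exact hr.not_gt ((half_lt_measure_Iio_iff P m).1 (hPJ.trans_le (measure_mono h)))
  · intro hm
    constructor <;> by_contra! h
    · obtain ⟨a, b, -, hsub, hab⟩ := exists_Icc_subset_lt_measure P isOpen_Ioi ordConnected_Ioi
        ((half_lt_measure_Ioi_iff P m).2 h)
      exact lt_irrefl m (hsub (hm _ ⟨isClosedIntervalR_Icc a b, hab⟩))
    · obtain ⟨a, b, -, hsub, hab⟩ := exists_Icc_subset_lt_measure P isOpen_Iio ordConnected_Iio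
        ((half_lt_measure_Iio_iff P m).2 h)
      exact lt_irrefl m (hsub (hm _ ⟨isClosedIntervalR_Icc a b, hab⟩))

theorem isClosed_half_le_measure_Iic (P : Measure ℝ) [IsProbabilityMeasure P] :
    IsClosed {m : ℝ | 1 / 2 ≤ P (Iic m)} := by
  refine ⟨isOpen_iff_mem_nhds.2 fun m hm => ?_⟩
  obtain ⟨a, b, hle, hsub, hab⟩ := exists_Icc_subset_lt_measure P isOpen_Ioi ordConnected_Ioi
    ((half_lt_measure_Ioi_iff P m).2 (not_le.1 hm))
  filter_upwards [Iio_mem_nhds (hsub (left_mem_Icc.2 hle))] with x hx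
  exact not_le.2 ((half_lt_measure_Ioi_iff P x).1
    (hab.trans_le (measure_mono fun y hy => lt_of_lt_of_le hx hy.1)))

theorem isClosed_half_le_measure_Ici (P : Measure ℝ) [IsProbabilityMeasure P] :
    IsClosed {m : ℝ | 1 / 2 ≤ P (Ici m)} := by
  refine ⟨isOpen_iff_mem_nhds.2 fun m hm => ?_⟩
  obtain ⟨a, b, hle, hsub, hab⟩ := exists_Icc_subset_lt_measure P isOpen_Iio ordConnected_Iio
    ((half_lt_measure_Iio_iff P m).2 (not_le.1 hm))
  filter_upwards [Ioi_mem_nhds (hsub (right_mem_Icc.2 hle))] with x hx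
  exact not_le.2 ((half_lt_measure_Iio_iff P x).1
    (hab.trans_le (measure_mono fun y hy => lt_of_le_of_lt hy.2 hx)))

theorem exists_Icc_half_lt_measure (P : Measure ℝ) [IsProbabilityMeasure P] :
    ∃ a b : ℝ, 1 / 2 < P (Icc a b) := by
  obtain ⟨a, b, -, -, hab⟩ := exists_Icc_subset_lt_measure P isOpen_univ ordConnected_univ
    (r := 1 / 2) (by simp)
  exact ⟨a, b, hab⟩

theorem medianSet_nonempty (P : Measure ℝ) [IsProbabilityMeasure P] :
    (medianSet P).Nonempty := by
  obtain ⟨a, b, hab⟩ := exists_Icc_half_lt_measure P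
  have hcover : (univ : Set ℝ) ⊆ {m | 1 / 2 ≤ P (Iic m)} ∪ {m | 1 / 2 ≤ P (Ici m)} := by
    intro x _
    by_contra! h
    obtain ⟨hl, hr⟩ := not_or.1 h
    exact hr (((half_lt_measure_Ioi_iff P x).2 (not_le.1 hl)).le.trans
      (measure_mono Ioi_subset_Ici_self))
  obtain ⟨m, -, hm⟩ := isPreconnected_closed_iff.1 isPreconnected_univ _ _
    (isClosed_half_le_measure_Iic P) (isClosed_half_le_measure_Ici P) hcover
    ⟨b, mem_univ b, hab.le.trans (measure_mono Icc_subset_Iic_self)⟩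
    ⟨a, mem_univ a, hab.le.trans (measure_mono Icc_subset_Ici_self)⟩
  exact ⟨m, hm⟩

theorem isCompact_medianSet (P : Measure ℝ) [IsProbabilityMeasure P] :
    IsCompact (medianSet P) := by
  obtain ⟨a, b, hab⟩ := exists_Icc_half_lt_measure P
  rw [medianSet_eq_sInter]
  exact isCompact_Icc.of_isClosed_subset (isClosed_sInter fun J hJ => hJ.1.isClosed)
    (sInter_subset_of_mem ⟨isClosedIntervalR_Icc a b, hab⟩)

theorem ordConnected_medianSet (P : Measure ℝ) [IsProbabilityMeasure P] :
    (medianSet P).OrdConnected := by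
  rw [medianSet_eq_sInter]
  exact ordConnected_sInter fun J hJ => hJ.1.ordConnected

theorem median_set_eq_inter_closed_intervals (P : Measure ℝ) [IsProbabilityMeasure P] :
    medianSet P = ⋂₀ {J : Set ℝ | IsClosedIntervalR J ∧ 1/2 < P J} ∧
    (medianSet P).Nonempty ∧ IsCompact (medianSet P) ∧
    ∃ a b : ℝ, medianSet P = Set.Icc a b := by
  exact ⟨medianSet_eq_sInter P, medianSet_nonempty P, isCompact_medianSet P, _, _,
    eq_Icc_of_connected_compact
      ⟨medianSet_nonempty P, (ordConnected_medianSet P).isPreconnected⟩ (isCompact_medianSet P)⟩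
end

section
/- Let ≼ be a partial order on ℝ^d satisfying conditions (I1) and (I3). Let 𝒥 be a family of generalized intervals with respect to ≼ such that every two members of 𝒥 have nonempty intersection, at least one member of 𝒥 has a finite lower endpoint (i.e., is of the form [a,b] or {x : a ≼ x} with a ∈ ℝ^d), and at least one member has a finite upper endpoint (i.e., is of the form [a,b] or {x : x ≼ b} with b ∈ ℝ^d). Then: (i) whenever a is a finite lower endpoint of some member and b is a finite upper endpoint of some (possibly different) member, a ≼ b; and (ii) the intersection of all members of 𝒥 equals the interval [a₀,b₀] = {x : a₀ ≼ x ≼ b₀}, where a₀ is the least upper bound of the set of finite lower endpoints and b₀ is the greatest lower bound of the set of finite upper endpoints, and this intersection is a nonempty compact set. -/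
open MeasureTheory Set

variable {d : ℕ}

/-- A generalized interval with respect to a relation `r`:
`[a,b] = {x | r a x ∧ r x b}`, `{x | r a x}`, `{x | r x b}`, or the whole space. -/
def IsGenInterval {E : Type*} (r : E → E → Prop) (J : Set E) : Prop :=
  (∃ a b : E, J = {x | r a x ∧ r x b}) ∨ (∃ a : E, J = {x | r a x}) ∨
    (∃ b : E, J = {x | r x b}) ∨ J = Set.univ

/-- Condition (I1): the one-sided intervals are closed and the two-sided (finite-endpoint)
intervals are compact. -/
def CondI1 {E : Type*} [TopologicalSpace E] (r : E → E → Prop) : Prop :=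
  (∀ a : E, IsClosed {x | r a x}) ∧ (∀ b : E, IsClosed {x | r x b}) ∧
    (∀ a b : E, IsCompact {x | r a x ∧ r x b})

/-- Condition (I3): sets bounded above (below) by a finite point have a least upper bound
(greatest lower bound). -/
def CondI3 {E : Type*} (r : E → E → Prop) : Prop :=
  (∀ S : Set E, S.Nonempty → (∃ u : E, ∀ s ∈ S, r s u) →
      ∃ a₀ : E, (∀ s ∈ S, r s a₀) ∧ ∀ u : E, (∀ s ∈ S, r s u) → r a₀ u) ∧
  (∀ S : Set E, S.Nonempty → (∃ l : E, ∀ s ∈ S, r l s) →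
      ∃ b₀ : E, (∀ s ∈ S, r b₀ s) ∧ ∀ l : E, (∀ s ∈ S, r l s) → r l b₀)

/-- `a` is a finite lower endpoint of the generalized interval `J`. -/
def IsLowerEndpointOf {E : Type*} (r : E → E → Prop) (a : E) (J : Set E) : Prop :=
  J = {x | r a x} ∨ ∃ b : E, J = {x | r a x ∧ r x b}

/-- `b` is a finite upper endpoint of the generalized interval `J`. -/
def IsUpperEndpointOf {E : Type*} (r : E → E → Prop) (b : E) (J : Set E) : Prop :=
  J = {x | r x b} ∨ ∃ a : E, J = {x | r a x ∧ r x b}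

/-- `a₀` is the least upper bound of `S` with respect to `r`. -/
def IsLUBrel {E : Type*} (r : E → E → Prop) (S : Set E) (a₀ : E) : Prop :=
  (∀ a ∈ S, r a a₀) ∧ ∀ u : E, (∀ a ∈ S, r a u) → r a₀ u

/-- `b₀` is the greatest lower bound of `S` with respect to `r`. -/
def IsGLBrel {E : Type*} (r : E → E → Prop) (S : Set E) (b₀ : E) : Prop :=
  (∀ b ∈ S, r b₀ b) ∧ ∀ l : E, (∀ b ∈ S, r l b) → r l b₀

theorem inter_of_pairwise_intersecting_intervals
    (r : EuclideanSpace ℝ (Fin d) → EuclideanSpace ℝ (Fin d) → Prop)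
    (hr : IsPartialOrder (EuclideanSpace ℝ (Fin d)) r)
    (hI1 : CondI1 r) (hI3 : CondI3 r)
    (𝒥 : Set (Set (EuclideanSpace ℝ (Fin d))))
    (h𝒥 : ∀ J ∈ 𝒥, IsGenInterval r J)
    (hpair : ∀ J ∈ 𝒥, ∀ J' ∈ 𝒥, (J ∩ J').Nonempty)
    (hlow : ∃ J ∈ 𝒥, ∃ a, IsLowerEndpointOf r a J)
    (hupp : ∃ J ∈ 𝒥, ∃ b, IsUpperEndpointOf r b J) :
    (∀ a b : EuclideanSpace ℝ (Fin d),
        (∃ J ∈ 𝒥, IsLowerEndpointOf r a J) → (∃ J ∈ 𝒥, IsUpperEndpointOf r b J) → r a b) ∧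
    ∃ a₀ b₀ : EuclideanSpace ℝ (Fin d),
      IsLUBrel r {a | ∃ J ∈ 𝒥, IsLowerEndpointOf r a J} a₀ ∧
      IsGLBrel r {b | ∃ J ∈ 𝒥, IsUpperEndpointOf r b J} b₀ ∧
      ⋂₀ 𝒥 = {x | r a₀ x ∧ r x b₀} ∧ (⋂₀ 𝒥).Nonempty ∧ IsCompact (⋂₀ 𝒥) := by
  have le_of_lower : ∀ {a J x}, IsLowerEndpointOf r a J → x ∈ J → r a x := by
    rintro a J x (rfl | ⟨b, rfl⟩) hx
    exacts [hx, hx.1]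
  have le_of_upper : ∀ {b J x}, IsUpperEndpointOf r b J → x ∈ J → r x b := by
    rintro b J x (rfl | ⟨a, rfl⟩) hx
    exacts [hx, hx.2]
  have lower_le_upper : ∀ a b : EuclideanSpace ℝ (Fin d),
      (∃ J ∈ 𝒥, IsLowerEndpointOf r a J) → (∃ J ∈ 𝒥, IsUpperEndpointOf r b J) → r a b := by
    rintro a b ⟨J, hJ, ha⟩ ⟨J', hJ', hb⟩
    obtain ⟨x, hx, hx'⟩ := hpair J hJ J' hJ'
    exact hr.trans _ _ _ (le_of_lower ha hx) (le_of_upper hb hx')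
  obtain ⟨J, hJ, a, ha⟩ := hlow
  obtain ⟨J', hJ', b, hb⟩ := hupp
  obtain ⟨a₀, ha₀⟩ := hI3.1 {a | ∃ J ∈ 𝒥, IsLowerEndpointOf r a J} ⟨a, J, hJ, ha⟩
    ⟨b, fun s hs => lower_le_upper s b hs ⟨J', hJ', hb⟩⟩
  obtain ⟨b₀, hb₀⟩ := hI3.2 {b | ∃ J ∈ 𝒥, IsUpperEndpointOf r b J} ⟨b, J', hJ', hb⟩
    ⟨a, fun s hs => lower_le_upper a s ⟨J, hJ, ha⟩ hs⟩
  have hab : r a₀ b₀ := ha₀.2 _ fun s hs => hb₀.2 _ fun t ht => lower_le_upper s t hs ht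
  have inter_eq : ⋂₀ 𝒥 = {x | r a₀ x ∧ r x b₀} := by
    ext x
    constructor
    · exact fun hx => ⟨ha₀.2 x fun s ⟨K, hK, hs⟩ => le_of_lower hs (hx K hK),
        hb₀.2 x fun s ⟨K, hK, hs⟩ => le_of_upper hs (hx K hK)⟩
    · rintro ⟨hax, hxb⟩ K hK
      have above : ∀ c, IsLowerEndpointOf r c K → r c x :=
        fun c hc => hr.trans _ _ _ (ha₀.1 c ⟨K, hK, hc⟩) hax
      have below : ∀ c, IsUpperEndpointOf r c K → r x c :=
        fun c hc => hr.trans _ _ _ hxb (hb₀.1 c ⟨K, hK, hc⟩)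
      rcases h𝒥 K hK with ⟨c, e, h⟩ | ⟨c, h⟩ | ⟨e, h⟩ | h
      · exact h ▸ ⟨above c (.inr ⟨e, h⟩), below e (.inr ⟨c, h⟩)⟩
      · exact h ▸ above c (.inl h)
      · exact h ▸ below e (.inl h)
      · exact h ▸ mem_univ x
  refine ⟨lower_le_upper, a₀, b₀, ha₀, hb₀, inter_eq, ?_, ?_⟩
  · exact inter_eq ▸ ⟨a₀, hr.refl a₀, hab⟩
  · exact inter_eq ▸ hI1.2.2 a₀ b₀
end

section
/- Let ≼ be a partial order on ℝ^d satisfying conditions (I1), (I2) and (I3), and let P be a Borel probability measure on ℝ^d. Then the intersection of all generalized intervals J with respect to ≼ satisfying P(J) > 1/2 is a nonempty compact set of the form [a,b] = {x : a ≼ x ≼ b} for some a,b ∈ ℝ^d. -/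
open MeasureTheory Set

/-- Condition (I2): every closed ball is contained in some interval `[a,b]`. -/
def CondI2 {E : Type*} [PseudoMetricSpace E] (r : E → E → Prop) : Prop :=
  ∀ (c : E) (ρ : ℝ), ∃ a b : E, Metric.closedBall c ρ ⊆ {x | r a x ∧ r x b}

/-- Under a probability measure, two sets of measure more than one half meet. -/
theorem exists_mem_inter_of_half_lt {E : Type*} [MeasurableSpace E] {P : Measure E}
    [IsProbabilityMeasure P] {S T : Set E} (hT : MeasurableSet T)
    (hPS : 1 / 2 < P S) (hPT : 1 / 2 < P T) : (S ∩ T).Nonempty := by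
  refine nonempty_inter_of_measure_lt_add P hT (subset_univ S) (subset_univ T) ?_
  calc P univ = 1 / 2 + 1 / 2 := by rw [measure_univ, ENNReal.add_halves]
    _ < P S + P T := ENNReal.add_lt_add hPS hPT

/-- Some closed ball around a given point carries more than half of the mass. -/
theorem exists_half_lt_measure_closedBall {E : Type*} [PseudoMetricSpace E] [MeasurableSpace E]
    (P : Measure E) [IsProbabilityMeasure P] (c : E) :
    ∃ n : ℕ, 1 / 2 < P (Metric.closedBall c n) := by
  have hmono : Monotone fun n : ℕ => Metric.closedBall c (n : ℝ) := fun m n h =>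
    Metric.closedBall_subset_closedBall (by exact_mod_cast h)
  have htend := tendsto_measure_iUnion_atTop (μ := P) hmono
  rw [Metric.iUnion_closedBall_nat, measure_univ] at htend
  have hhalf : (1 / 2 : ENNReal) < 1 := by
    rw [one_div]
    exact ENNReal.one_half_lt_one
  exact (htend.eventually (lt_mem_nhds hhalf)).exists

/-- The intersection of the generalized intervals of mass more than one half is the
intersection of the one-sided ones among them. -/
theorem mem_sInter_half_lt_iff {E : Type*} [MeasurableSpace E] (r : E → E → Prop)
    (P : Measure E) (x : E) :
    x ∈ ⋂₀ {J | IsGenInterval r J ∧ 1 / 2 < P J} ↔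
      (∀ a, 1 / 2 < P {y | r a y} → r a x) ∧ ∀ b, 1 / 2 < P {y | r y b} → r x b := by
  constructor
  · intro hx
    exact ⟨fun a ha => hx _ ⟨Or.inr (Or.inl ⟨a, rfl⟩), ha⟩,
      fun b hb => hx _ ⟨Or.inr (Or.inr (Or.inl ⟨b, rfl⟩)), hb⟩⟩
  · rintro ⟨hA, hB⟩ J ⟨⟨a, b, rfl⟩ | ⟨a, rfl⟩ | ⟨b, rfl⟩ | rfl, hJ⟩
    · exact ⟨hA a (hJ.trans_le (measure_mono fun _ hy => hy.1)),
        hB b (hJ.trans_le (measure_mono fun _ hy => hy.2))⟩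
    · exact hA a hJ
    · exact hB b hJ
    · trivial

theorem median_interval_of_partial_order {d : ℕ}
    (r : EuclideanSpace ℝ (Fin d) → EuclideanSpace ℝ (Fin d) → Prop)
    (hr : IsPartialOrder (EuclideanSpace ℝ (Fin d)) r)
    (hI1 : CondI1 r) (hI2 : CondI2 r) (hI3 : CondI3 r)
    (P : Measure (EuclideanSpace ℝ (Fin d))) [IsProbabilityMeasure P] :
    ∃ a b : EuclideanSpace ℝ (Fin d),
      ⋂₀ {J | IsGenInterval r J ∧ 1/2 < P J} = {x | r a x ∧ r x b} ∧
      (⋂₀ {J | IsGenInterval r J ∧ 1/2 < P J}).Nonempty ∧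
      IsCompact (⋂₀ {J | IsGenInterval r J ∧ 1/2 < P J}) := by
  obtain ⟨n, hn⟩ := exists_half_lt_measure_closedBall P 0
  obtain ⟨a₀, b₀, hab₀⟩ := hI2 0 n
  have ha₀ : 1 / 2 < P {x | r a₀ x} := hn.trans_le (measure_mono fun _ hx => (hab₀ hx).1)
  have hb₀ : 1 / 2 < P {x | r x b₀} := hn.trans_le (measure_mono fun _ hx => (hab₀ hx).2)
  have hAB : ∀ a b, 1 / 2 < P {x | r a x} → 1 / 2 < P {x | r x b} → r a b := by
    intro a b ha hb
    obtain ⟨x, hax, hxb⟩ := exists_mem_inter_of_half_lt (hI1.2.1 b).measurableSet ha hb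
    exact hr.trans _ _ _ hax hxb
  obtain ⟨a, haA, ha⟩ := hI3.1 {a | 1 / 2 < P {x | r a x}} ⟨a₀, ha₀⟩
    ⟨b₀, fun a h => hAB a b₀ h hb₀⟩
  obtain ⟨b, hbB, hb⟩ := hI3.2 {b | 1 / 2 < P {x | r x b}} ⟨b₀, hb₀⟩
    ⟨a₀, fun b h => hAB a₀ b ha₀ h⟩
  have hab : r a b := hb a fun b' hb' => ha b' fun a' ha' => hAB a' b' ha' hb'
  have heq : ⋂₀ {J | IsGenInterval r J ∧ 1/2 < P J} = {x | r a x ∧ r x b} := by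
    ext x
    rw [mem_sInter_half_lt_iff]
    exact ⟨fun h => ⟨ha x h.1, hb x h.2⟩, fun h =>
      ⟨fun a' ha' => hr.trans _ _ _ (haA a' ha') h.1,
        fun b' hb' => hr.trans _ _ _ h.2 (hbB b' hb')⟩⟩
  refine ⟨a, b, heq, ?_, ?_⟩
  · rw [heq]
    exact ⟨a, hr.refl a, hab⟩
  · rw [heq]
    exact hI1.2.2 a b
end

section
/- Let d > 1, let ≼ be the coordinate-wise partial order on ℝ^d (x ≼ y iff x_i ≤ y_i for all i = 1,…,d), and let X be a random vector in ℝ^d with distribution P and marginal distributions P_1,…,P_d. Then the median set of P with respect to ≼ equals the Cartesian product {Med X_1} × {Med X_2} × ⋯ × {Med X_d}, where {Med X_i} = {m ∈ ℝ : P_i((−∞,m]) ≥ 1/2 and P_i([m,∞)) ≥ 1/2} is the one-dimensional median set of the i-th marginal. -/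
open MeasureTheory Set

/-- The coordinate-wise partial order on `ℝ^d`. -/
def coordLE {d : ℕ} (x y : EuclideanSpace ℝ (Fin d)) : Prop := ∀ i, x i ≤ y i

/-- Two disjoint events of probability at least `1/2` and more than `1/2` cannot coexist. -/
lemma not_disjoint_of_half_le_of_half_lt {E : Type*} [MeasurableSpace E] (P : Measure E)
    [IsProbabilityMeasure P] {A B : Set E} (hA : MeasurableSet A) (hPA : 1/2 ≤ P A)
    (hPB : 1/2 < P B) : ¬ Disjoint A B := by
  intro h
  have hle : P A + P B ≤ 1 := by
    rw [← measure_union' h hA]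
    exact prob_le_one
  have hlt : (1/2 : ENNReal) + 1/2 < P A + P B :=
    ENNReal.add_lt_add_of_le_of_lt (by simp) hPA hPB
  rw [ENNReal.add_halves] at hlt
  exact absurd hle (not_le.mpr hlt)

/-- If an event has probability less than `1/2`, its complement has probability
more than `1/2`. -/
lemma half_lt_prob_compl {E : Type*} [MeasurableSpace E] (P : Measure E)
    [IsProbabilityMeasure P] {A : Set E} (hA : MeasurableSet A) (hPA : P A < 1/2) :
    1/2 < P Aᶜ := by
  by_contra! h
  have hlt : P A + P Aᶜ < 1/2 + 1/2 :=
    ENNReal.add_lt_add_of_lt_of_le (measure_ne_top P _) hPA h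
  rw [prob_add_prob_compl hA, ENNReal.add_halves] at hlt
  exact lt_irrefl _ hlt

/-- An open coordinate half-space can be approximated in measure from inside by upper orthants. -/
lemma exists_upper_orthant_measure_gt {d : ℕ} (P : Measure (EuclideanSpace ℝ (Fin d)))
    (i : Fin d) {c : ℝ} {t : ENNReal} (h : t < P {x | c < x i}) :
    ∃ a : EuclideanSpace ℝ (Fin d), c < a i ∧ t < P {x | coordLE a x} := by
  let a : ℕ → EuclideanSpace ℝ (Fin d) := fun n =>
    WithLp.toLp 2 fun j => if j = i then c + 1 / ((n : ℝ) + 1) else -(n : ℝ)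
  have ha : ∀ n j, a n j = if j = i then c + 1 / ((n : ℝ) + 1) else -(n : ℝ) := fun _ _ => rfl
  have hanti : ∀ m n, m ≤ n → coordLE (a n) (a m) := by
    intro m n hmn j
    rw [ha, ha]
    split_ifs
    · gcongr
    · gcongr
  have hmono : Monotone fun n => {x | coordLE (a n) x} :=
    fun m n hmn x hx j => (hanti m n hmn j).trans (hx j)
  have hsub : {x : EuclideanSpace ℝ (Fin d) | c < x i} ⊆ ⋃ n, {x | coordLE (a n) x} := by
    intro x hx
    obtain ⟨k, hk⟩ := exists_nat_one_div_lt (sub_pos.mpr (show c < x i from hx))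
    obtain ⟨l, hl⟩ := exists_nat_ge (∑ j, |x j|)
    refine mem_iUnion.mpr ⟨max k l, fun j => ?_⟩
    by_cases hj : j = i
    · refine (hanti k _ (le_max_left k l) j).trans ?_
      rw [ha, if_pos hj, hj]
      linarith
    · refine (hanti l _ (le_max_right k l) j).trans ?_
      rw [ha, if_neg hj]
      have := Finset.single_le_sum (f := fun j => |x j|) (fun _ _ => abs_nonneg _)
        (Finset.mem_univ j)
      linarith [neg_abs_le (x j)]
  have hlt := h.trans_le (measure_mono hsub)
  rw [hmono.measure_iUnion, lt_iSup_iff] at hlt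
  obtain ⟨n, hn⟩ := hlt
  refine ⟨a n, ?_, hn⟩
  rw [ha, if_pos rfl]
  linarith [Nat.one_div_pos_of_nat (α := ℝ) (n := n)]

/-- An open coordinate half-space can be approximated in measure from inside by lower orthants. -/
lemma exists_lower_orthant_measure_gt {d : ℕ} (P : Measure (EuclideanSpace ℝ (Fin d)))
    (i : Fin d) {c : ℝ} {t : ENNReal} (h : t < P {x | x i < c}) :
    ∃ b : EuclideanSpace ℝ (Fin d), b i < c ∧ t < P {x | coordLE x b} := by
  have hmap : ∀ s, P.map (fun x => -x) s = P ((fun x => -x) ⁻¹' s) :=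
    (MeasurableEquiv.neg (EuclideanSpace ℝ (Fin d))).map_apply
  obtain ⟨a, hac, ha⟩ := exists_upper_orthant_measure_gt (P.map fun x => -x) i (c := -c) (t := t)
    (by simpa [hmap] using h)
  refine ⟨-a, by simpa using neg_lt.mp hac, ?_⟩
  rw [hmap] at ha
  convert ha using 3
  ext x
  exact forall_congr' fun j => by simp [le_neg]

theorem median_set_coordinatewise_eq_product_of_marginal_medians {d : ℕ} (hd : 1 < d)
    (P : Measure (EuclideanSpace ℝ (Fin d))) [IsProbabilityMeasure P] :
    ⋂₀ {J | IsGenInterval (coordLE (d := d)) J ∧ 1/2 < P J} =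
      {m : EuclideanSpace ℝ (Fin d) | ∀ i : Fin d,
        1/2 ≤ P.map (fun x => x i) (Set.Iic (m i)) ∧
        1/2 ≤ P.map (fun x => x i) (Set.Ici (m i))} := by
  have hmeas : ∀ i : Fin d, Measurable fun x : EuclideanSpace ℝ (Fin d) => x i :=
    fun i => by fun_prop
  ext m
  constructor
  · intro hm i
    rw [Measure.map_apply (hmeas i) measurableSet_Iic,
      Measure.map_apply (hmeas i) measurableSet_Ici]
    constructor
    · by_contra! h
      have h' := half_lt_prob_compl P (hmeas i measurableSet_Iic) h
      rw [← preimage_compl, compl_Iic] at h'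
      obtain ⟨a, hai, ha⟩ := exists_upper_orthant_measure_gt P i h'
      exact hai.not_ge (hm _ ⟨Or.inr (Or.inl ⟨a, rfl⟩), ha⟩ i)
    · by_contra! h
      have h' := half_lt_prob_compl P (hmeas i measurableSet_Ici) h
      rw [← preimage_compl, compl_Ici] at h'
      obtain ⟨b, hbi, hb⟩ := exists_lower_orthant_measure_gt P i h'
      exact hbi.not_ge (hm _ ⟨Or.inr (Or.inr (Or.inl ⟨b, rfl⟩)), hb⟩ i)
  · rintro hm J ⟨hJ, hPJ⟩
    have hlower : ∀ a, J ⊆ {x | coordLE a x} → coordLE a m := by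
      intro a hJa i
      have hi := (hm i).1
      rw [Measure.map_apply (hmeas i) measurableSet_Iic] at hi
      obtain ⟨x, hx, hxJ⟩ := not_disjoint_iff.mp
        (not_disjoint_of_half_le_of_half_lt P (hmeas i measurableSet_Iic) hi hPJ)
      exact (hJa hxJ i).trans hx
    have hupper : ∀ b, J ⊆ {x | coordLE x b} → coordLE m b := by
      intro b hJb i
      have hi := (hm i).2
      rw [Measure.map_apply (hmeas i) measurableSet_Ici] at hi
      obtain ⟨x, hx, hxJ⟩ := not_disjoint_iff.mp
        (not_disjoint_of_half_le_of_half_lt P (hmeas i measurableSet_Ici) hi hPJ)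
      exact le_trans hx (hJb hxJ i)
    rcases hJ with ⟨a, b, rfl⟩ | ⟨a, rfl⟩ | ⟨b, rfl⟩ | rfl
    · exact ⟨hlower a fun _ hx => hx.1, hupper b fun _ hx => hx.2⟩
    · exact hlower a Subset.rfl
    · exact hupper b Subset.rfl
    · exact mem_univ m
end

section
/- Let ≼ be the coordinate-wise partial order on ℝ^d and P a Borel probability measure on ℝ^d. Let 𝒥 be the family of all generalized intervals J with respect to ≼ such that P(J) > 1/2, and let ℐ be the family of all generalized intervals I such that every generalized interval strictly containing I belongs to 𝒥. Then: (i) every I ∈ ℐ equals the intersection of all J ∈ 𝒥 with I ⊆ J; and (ii) the intersection of all members of ℐ equals the intersection of all members of 𝒥. -/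
open MeasureTheory Set

/-- The vector `x` with every coordinate shifted by `t`. -/
noncomputable def coordShift {d : ℕ} (x : EuclideanSpace ℝ (Fin d)) (t : ℝ) :
    EuclideanSpace ℝ (Fin d) :=
  WithLp.toLp 2 fun i => x i + t

@[simp]
theorem coordShift_apply {d : ℕ} (x : EuclideanSpace ℝ (Fin d)) (t : ℝ) (i : Fin d) :
    coordShift x t i = x i + t :=
  rfl

/-- A point outside a generalized interval for the coordinate-wise order is also outside some
strictly larger generalized interval. -/
theorem IsGenInterval.exists_ssuperset_notMem {d : ℕ} {I : Set (EuclideanSpace ℝ (Fin d))}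
    (hI : IsGenInterval coordLE I) {x : EuclideanSpace ℝ (Fin d)} (hx : x ∉ I) :
    ∃ J, IsGenInterval coordLE J ∧ I ⊂ J ∧ x ∉ J := by
  rcases hI with ⟨a, b, rfl⟩ | ⟨a, rfl⟩ | ⟨b, rfl⟩ | rfl
  · by_cases hab : coordLE a b
    · obtain ⟨ε, hε, i, hi⟩ : ∃ ε > 0, ∃ i, x i < a i - ε ∨ b i + ε < x i := by
        simp only [coordLE, mem_ofPred_eq, not_and_or, not_forall, not_le] at hx
        rcases hx with ⟨i, hi⟩ | ⟨i, hi⟩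
        · exact ⟨(a i - x i) / 2, by linarith, i, Or.inl (by linarith)⟩
        · exact ⟨(x i - b i) / 2, by linarith, i, Or.inr (by linarith)⟩
      refine ⟨{y | coordLE (coordShift a (-ε)) y ∧ coordLE y (coordShift b ε)},
        Or.inl ⟨_, _, rfl⟩, ⟨fun y hy => ⟨fun j => ?_, fun j => ?_⟩, fun h => ?_⟩, fun h => ?_⟩
      · have := hy.1 j
        simp only [coordShift_apply]
        linarith
      · have := hy.2 j
        simp only [coordShift_apply]
        linarith
      · have hmem := h (a := coordShift a (-ε)) ⟨fun j => le_rfl, fun j => by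
          have := hab j
          simp only [coordShift_apply]
          linarith⟩
        have := hmem.1 i
        simp only [coordShift_apply] at this
        linarith
      · have h₁ := h.1 i
        have h₂ := h.2 i
        simp only [coordShift_apply] at h₁ h₂
        rcases hi with hi | hi <;> linarith
    · obtain ⟨i, -⟩ := not_forall.1 hab
      refine ⟨{y | coordLE (coordShift x 1) y ∧ coordLE y (coordShift x 1)},
        Or.inl ⟨_, _, rfl⟩, ⟨fun y hy => ?_, fun h => ?_⟩, fun h => ?_⟩
      · exact absurd (fun j => (hy.1 j).trans (hy.2 j)) hab
      · have hmem := h (a := coordShift x 1) ⟨fun j => le_rfl, fun j => le_rfl⟩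
        exact hab fun j => (hmem.1 j).trans (hmem.2 j)
      · have := h.1 i
        simp only [coordShift_apply] at this
        linarith
  · obtain ⟨i, hi⟩ := not_forall.1 hx
    rw [not_le] at hi
    refine ⟨{y | coordLE (coordShift a (-((a i - x i) / 2))) y}, Or.inr (Or.inl ⟨_, rfl⟩),
      ⟨fun y hy j => ?_, fun h => ?_⟩, fun h => ?_⟩
    · have := hy j
      simp only [coordShift_apply]
      linarith
    · have := h (a := coordShift a (-((a i - x i) / 2))) (fun j => le_rfl) i
      simp only [coordShift_apply] at this
      linarith
    · have := h i
      simp only [coordShift_apply] at this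
      linarith
  · obtain ⟨i, hi⟩ := not_forall.1 hx
    rw [not_le] at hi
    refine ⟨{y | coordLE y (coordShift b ((x i - b i) / 2))}, Or.inr (Or.inr (Or.inl ⟨_, rfl⟩)),
      ⟨fun y hy j => ?_, fun h => ?_⟩, fun h => ?_⟩
    · have := hy j
      simp only [coordShift_apply]
      linarith
    · have := h (a := coordShift b ((x i - b i) / 2)) (fun j => le_rfl) i
      simp only [coordShift_apply] at this
      linarith
    · have := h i
      simp only [coordShift_apply] at this
      linarith
  · exact absurd (mem_univ x) hx

theorem inter_over_strict_superinterval_family {d : ℕ}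
    (P : Measure (EuclideanSpace ℝ (Fin d))) [IsProbabilityMeasure P]
    (𝒥 ℐ : Set (Set (EuclideanSpace ℝ (Fin d))))
    (h𝒥 : 𝒥 = {J | IsGenInterval (coordLE (d := d)) J ∧ 1/2 < P J})
    (hℐ : ℐ = {I | IsGenInterval (coordLE (d := d)) I ∧
        ∀ J : Set (EuclideanSpace ℝ (Fin d)), IsGenInterval (coordLE (d := d)) J → I ⊂ J → J ∈ 𝒥}) :
    (∀ I ∈ ℐ, I = ⋂₀ {J | J ∈ 𝒥 ∧ I ⊆ J}) ∧ ⋂₀ ℐ = ⋂₀ 𝒥 := by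
  have hinter : ∀ I ∈ ℐ, I = ⋂₀ {J | J ∈ 𝒥 ∧ I ⊆ J} := by
    intro I hI
    rw [hℐ] at hI
    refine Subset.antisymm (subset_sInter fun J hJ => hJ.2) fun x hx => ?_
    by_contra hxI
    obtain ⟨J, hJ, hIJ, hxJ⟩ := hI.1.exists_ssuperset_notMem hxI
    exact hxJ (hx J ⟨hI.2 J hJ hIJ, hIJ.subset⟩)
  refine ⟨hinter, Subset.antisymm (sInter_subset_sInter fun J hJ => ?_)
    (subset_sInter fun I hI => ?_)⟩
  · rw [h𝒥] at hJ
    rw [hℐ, h𝒥]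
    exact ⟨hJ.1, fun K hK hJK => ⟨hK, hJ.2.trans_le (measure_mono hJK.subset)⟩⟩
  · rw [hinter I hI]
    exact sInter_subset_sInter fun J hJ => hJ.1
end

section
/- Let 𝒱 be a collection of closed subsets of ℝ^d, let 𝒰 = {V^c : V ∈ 𝒱}, and assume condition (C1) holds for 𝒰. Then for every Borel probability measure P on ℝ^d, the function x ↦ D(x; P, 𝒰) is upper semicontinuous on ℝ^d. -/
open MeasureTheory Set

/-- The type D depth function: `D(x; P, 𝒰) = inf { P(U) : U ∈ 𝒰, x ∈ U }`. -/
noncomputable def depth {d : ℕ} (P : Measure (EuclideanSpace ℝ (Fin d)))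
    (𝒰 : Set (Set (EuclideanSpace ℝ (Fin d)))) (x : EuclideanSpace ℝ (Fin d)) : ENNReal :=
  sInf {p | ∃ U ∈ 𝒰, x ∈ U ∧ P U = p}

theorem depth_upperSemicontinuous {d : ℕ}
    (𝒱 : Set (Set (EuclideanSpace ℝ (Fin d)))) (h𝒱 : ∀ V ∈ 𝒱, IsClosed V)
    (𝒰 : Set (Set (EuclideanSpace ℝ (Fin d)))) (h𝒰 : 𝒰 = compl '' 𝒱)
    (hC1 : ∀ x : EuclideanSpace ℝ (Fin d), ∃ U ∈ 𝒰, x ∈ U)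
    (P : Measure (EuclideanSpace ℝ (Fin d))) [IsProbabilityMeasure P] :
    UpperSemicontinuous (fun x => depth P 𝒰 x) := by
  subst h𝒰
  intro x y hxy
  obtain ⟨_, ⟨_, ⟨V, hV, rfl⟩, hx, rfl⟩, hlt⟩ := sInf_lt_iff.mp hxy
  filter_upwards [(h𝒱 V hV).isOpen_compl.mem_nhds hx] with z hz
  exact lt_of_le_of_lt (sInf_le ⟨Vᶜ, mem_image_of_mem compl hV, hz, rfl⟩) hlt
end

section
/- Let 𝒱 be a collection of closed subsets of ℝ^d, let 𝒰 = {V^c : V ∈ 𝒱}, let P be a Borel probability measure on ℝ^d, and assume conditions (C1), (C2') and (C2'') hold. Then the function x ↦ D(x; P, 𝒰) attains a maximum value α_m on ℝ^d; the set C(P,𝒰) = {x : D(x; P, 𝒰) = α_m} is a nonempty compact set; C(P,𝒰) equals the intersection of all nonempty sets S_α(P,𝒰); and C(P,𝒰) = ⋂ {V ∈ 𝒱 : P(V) > 1 − α_m}. -/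
open MeasureTheory Set

/-- The level set `S_α(P,𝒰) = {x : D(x;P,𝒰) ≥ α}`. -/
def levelSet {d : ℕ} (P : Measure (EuclideanSpace ℝ (Fin d)))
    (𝒰 : Set (Set (EuclideanSpace ℝ (Fin d)))) (α : ENNReal) :
    Set (EuclideanSpace ℝ (Fin d)) :=
  {x | α ≤ depth P 𝒰 x}

theorem le_depth_iff {d : ℕ} {P : Measure (EuclideanSpace ℝ (Fin d))}
    {𝒰 : Set (Set (EuclideanSpace ℝ (Fin d)))} {x : EuclideanSpace ℝ (Fin d)} {α : ENNReal} :
    α ≤ depth P 𝒰 x ↔ ∀ U ∈ 𝒰, x ∈ U → α ≤ P U := by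
  simp only [depth, le_sInf_iff]
  constructor
  · exact fun h U hU hx => h _ ⟨U, hU, hx, rfl⟩
  · rintro h _ ⟨U, hU, hx, rfl⟩
    exact h U hU hx

/-- The depth function of a family of open sets is upper semicontinuous. -/
theorem upperSemicontinuous_depth {d : ℕ} (P : Measure (EuclideanSpace ℝ (Fin d)))
    {𝒰 : Set (Set (EuclideanSpace ℝ (Fin d)))} (h𝒰 : ∀ U ∈ 𝒰, IsOpen U) :
    UpperSemicontinuous (depth P 𝒰) := by
  intro x a hxa
  obtain ⟨_, ⟨U, hU, hx, rfl⟩, hUa⟩ := sInf_lt_iff.1 hxa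
  filter_upwards [(h𝒰 U hU).mem_nhds hx] with y hy
  exact (le_depth_iff.1 le_rfl U hU hy).trans_lt hUa

/-- For a family of open sets, level sets of positive level are compact as soon as the depth
vanishes at infinity. -/
theorem isCompact_levelSet {d : ℕ} (P : Measure (EuclideanSpace ℝ (Fin d)))
    {𝒰 : Set (Set (EuclideanSpace ℝ (Fin d)))} (h𝒰 : ∀ U ∈ 𝒰, IsOpen U)
    (hinf : ∀ ε : ENNReal, 0 < ε → ∃ R : ℝ,
      ∀ x : EuclideanSpace ℝ (Fin d), R < ‖x‖ → depth P 𝒰 x < ε)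
    {α : ENNReal} (hα : 0 < α) : IsCompact (levelSet P 𝒰 α) := by
  obtain ⟨R, hR⟩ := hinf α hα
  refine (isCompact_closedBall (0 : EuclideanSpace ℝ (Fin d)) R).of_isClosed_subset
    ((upperSemicontinuous_depth P h𝒰).isClosed_preimage α) fun x hx => ?_
  rw [mem_closedBall_zero_iff]
  exact not_lt.1 fun h => (hR x h).not_ge hx

/-- The level sets are intersections of the complements of the sets of small probability. -/
theorem levelSet_compl_eq_sInter {d : ℕ} (P : Measure (EuclideanSpace ℝ (Fin d)))
    [IsProbabilityMeasure P] {𝒱 : Set (Set (EuclideanSpace ℝ (Fin d)))}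
    (h𝒱 : ∀ V ∈ 𝒱, MeasurableSet V) {α : ENNReal} (hα : α ≤ 1) :
    levelSet P (compl '' 𝒱) α = ⋂₀ {V | V ∈ 𝒱 ∧ 1 - α < P V} := by
  ext x
  simp only [levelSet, mem_ofPred_eq, le_depth_iff, forall_mem_image, mem_compl_iff, mem_sInter,
    and_imp]
  refine forall₂_congr fun V hV => ?_
  rw [prob_compl_eq_one_sub (h𝒱 V hV),
    (ENNReal.cancel_of_ne (hα.trans_lt ENNReal.one_lt_top).ne).le_tsub_iff_le_tsub
      (ENNReal.cancel_of_ne (measure_ne_top P V)) hα prob_le_one, ← not_lt, not_imp_not]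

theorem center_nonempty_compact_and_representation {d : ℕ}
    (𝒱 : Set (Set (EuclideanSpace ℝ (Fin d)))) (h𝒱 : ∀ V ∈ 𝒱, IsClosed V)
    (𝒰 : Set (Set (EuclideanSpace ℝ (Fin d)))) (h𝒰 : 𝒰 = compl '' 𝒱)
    (P : Measure (EuclideanSpace ℝ (Fin d))) [IsProbabilityMeasure P]
    (hC1 : ∀ x : EuclideanSpace ℝ (Fin d), ∃ U ∈ 𝒰, x ∈ U)
    (hC2' : ∃ x : EuclideanSpace ℝ (Fin d), 0 < depth P 𝒰 x)
    (hC2'' : ∀ ε : ENNReal, 0 < ε → ∃ R : ℝ,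
        ∀ x : EuclideanSpace ℝ (Fin d), R < ‖x‖ → depth P 𝒰 x < ε) :
    ∃ αm : ENNReal,
      (∃ x, depth P 𝒰 x = αm) ∧ (∀ x, depth P 𝒰 x ≤ αm) ∧
      ({x | depth P 𝒰 x = αm}).Nonempty ∧
      IsCompact {x | depth P 𝒰 x = αm} ∧
      ({x | depth P 𝒰 x = αm} =
        ⋂ α ∈ {α : ENNReal | (levelSet P 𝒰 α).Nonempty}, levelSet P 𝒰 α) ∧
      {x | depth P 𝒰 x = αm} = ⋂₀ {V | V ∈ 𝒱 ∧ 1 - αm < P V} := by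
  have hopen : ∀ U ∈ 𝒰, IsOpen U := by
    subst h𝒰
    rintro _ ⟨V, hV, rfl⟩
    exact (h𝒱 V hV).isOpen_compl
  obtain ⟨x₀, hx₀⟩ := hC2'
  obtain ⟨m, hm, hmax⟩ := ((upperSemicontinuous_depth P hopen).upperSemicontinuousOn
    _).exists_isMaxOn ⟨x₀, le_refl (depth P 𝒰 x₀)⟩ (isCompact_levelSet P hopen hC2'' hx₀)
  have hle : ∀ x, depth P 𝒰 x ≤ depth P 𝒰 m := fun x =>
    (le_total (depth P 𝒰 x₀) (depth P 𝒰 x)).elim (fun h => hmax h) fun h => h.trans hm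
  have hcenter : {x | depth P 𝒰 x = depth P 𝒰 m} = levelSet P 𝒰 (depth P 𝒰 m) :=
    Set.ext fun x => ⟨fun h => h.ge, fun h => (hle x).antisymm h⟩
  have hone : depth P 𝒰 m ≤ 1 := by
    obtain ⟨U, hU, hmU⟩ := hC1 m
    exact (le_depth_iff.1 le_rfl U hU hmU).trans prob_le_one
  refine ⟨depth P 𝒰 m, ⟨m, rfl⟩, hle, ⟨m, rfl⟩, ?_, ?_, ?_⟩
  · rw [hcenter]
    exact isCompact_levelSet P hopen hC2'' (hx₀.trans_le hm)
  · rw [hcenter]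
    refine Subset.antisymm (subset_iInter₂ ?_) (biInter_subset_of_mem ⟨m, le_refl (depth P 𝒰 m)⟩)
    rintro α ⟨y, hy⟩ x hx
    exact (le_trans hy (hle y)).trans hx
  · rw [hcenter]
    subst h𝒰
    exact levelSet_compl_eq_sInter P (fun V hV => (h𝒱 V hV).measurableSet) hone
end

section
/- Let P be a Borel probability measure on ℝ^d, let K ⊆ ℝ^d be a compact set, and let 𝒜 be a nonempty family of closed convex subsets of K with P(A) > d/(d+1) for every A ∈ 𝒜. Then the intersection of all sets in 𝒜 is a nonempty compact set. -/
open MeasureTheory Set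

/-- Under a probability measure, at most `n + 1` measurable sets, each of measure greater than
`n / (n + 1)`, have a common point. -/
theorem nonempty_sInter_of_div_add_one_lt_measure {Ω : Type*} [MeasurableSpace Ω]
    (P : Measure Ω) [IsProbabilityMeasure P] {n : ℕ} {G : Finset (Set Ω)}
    (hcard : G.card ≤ n + 1) (hmeas : ∀ A ∈ G, MeasurableSet A)
    (hP : ∀ A ∈ G, (n : ENNReal) / ((n : ENNReal) + 1) < P A) :
    (⋂₀ (G : Set (Set Ω))).Nonempty := by
  have hcompl : ∀ A ∈ G, P.real Aᶜ < 1 / ((n : ℝ) + 1) := by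
    intro A hA
    have h := ENNReal.toReal_strict_mono (measure_ne_top P A) (hP A hA)
    rw [ENNReal.toReal_div, ENNReal.toReal_add (by simp) (by simp), ENNReal.toReal_natCast,
      ENNReal.toReal_one] at h
    rw [probReal_compl_eq_one_sub (hmeas A hA)]
    have hsum : (n : ℝ) / (n + 1) + 1 / (n + 1) = 1 := by field_simp
    change _ < P.real A at h
    linarith
  rcases G.eq_empty_or_nonempty with rfl | hG
  · have := nonempty_of_isProbabilityMeasure P
    simp
  by_contra hempty
  have huniv : ⋃ A ∈ G, Aᶜ = univ := by
    rw [not_nonempty_iff_eq_empty, sInter_eq_biInter] at hempty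
    rw [← compl_empty, ← hempty]
    simp [compl_iInter]
  have hle : 1 ≤ ∑ A ∈ G, P.real Aᶜ := by
    have h := measureReal_biUnion_finset_le (μ := P) G (fun A ↦ Aᶜ)
    rwa [huniv, probReal_univ] at h
  have hlt : ∑ A ∈ G, P.real Aᶜ < G.card * (1 / ((n : ℝ) + 1)) := by
    simpa using Finset.sum_lt_sum_of_nonempty hG hcompl
  have hone : (G.card : ℝ) * (1 / ((n : ℝ) + 1)) ≤ 1 := by
    rw [mul_one_div, div_le_one (by positivity)]
    exact_mod_cast hcard
  linarith

theorem inter_of_convex_sets_of_large_measure {d : ℕ}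
    (P : Measure (EuclideanSpace ℝ (Fin d))) [IsProbabilityMeasure P]
    (K : Set (EuclideanSpace ℝ (Fin d))) (hK : IsCompact K)
    (𝒜 : Set (Set (EuclideanSpace ℝ (Fin d)))) (h𝒜 : 𝒜.Nonempty)
    (hsub : ∀ A ∈ 𝒜, A ⊆ K)
    (hclosed : ∀ A ∈ 𝒜, IsClosed A)
    (hconv : ∀ A ∈ 𝒜, Convex ℝ A)
    (hP : ∀ A ∈ 𝒜, (d : ENNReal) / ((d : ENNReal) + 1) < P A) :
    (⋂₀ 𝒜).Nonempty ∧ IsCompact (⋂₀ 𝒜) := by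
  have hcompact : ∀ A ∈ 𝒜, IsCompact A := fun A hA ↦
    hK.of_isClosed_subset (hclosed A hA) (hsub A hA)
  obtain ⟨A, hA⟩ := h𝒜
  refine ⟨Convex.helly_theorem_set_compact' hconv hcompact fun G hG hcard ↦ ?_,
    (hcompact A hA).of_isClosed_subset (isClosed_sInter hclosed) (sInter_subset_of_mem hA)⟩
  rw [finrank_euclideanSpace_fin] at hcard
  exact nonempty_sInter_of_div_add_one_lt_measure P hcard
    (fun B hB ↦ (hclosed B (hG hB)).measurableSet) fun B hB ↦ hP B (hG hB)
end

section
/- Let 𝒱 be a family of closed convex subsets of ℝ^d, let 𝒰 = {V^c : V ∈ 𝒱}, assume condition (C1) holds, and let P be a Borel probability measure on ℝ^d. If K ⊆ ℝ^d is a compact convex set with P(K) = 1 − δ > 0 for some δ ∈ [0,1), then there exists a point x ∈ K with D(x; P, 𝒰) ≥ (1 − δ)/(d+1). -/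
open MeasureTheory Set

theorem exists_deep_point_in_compact_convex {d : ℕ}
    (𝒱 : Set (Set (EuclideanSpace ℝ (Fin d))))
    (h𝒱 : ∀ V ∈ 𝒱, IsClosed V ∧ Convex ℝ V)
    (𝒰 : Set (Set (EuclideanSpace ℝ (Fin d)))) (h𝒰 : 𝒰 = compl '' 𝒱)
    (hC1 : ∀ x : EuclideanSpace ℝ (Fin d), ∃ U ∈ 𝒰, x ∈ U)
    (P : Measure (EuclideanSpace ℝ (Fin d))) [IsProbabilityMeasure P]
    (K : Set (EuclideanSpace ℝ (Fin d))) (hK : IsCompact K) (hKconv : Convex ℝ K)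
    (δ : ENNReal) (hδ : δ < 1) (hPK : P K = 1 - δ) :
    ∃ x ∈ K, (1 - δ) / ((d : ENNReal) + 1) ≤ depth P 𝒰 x := by
  have hKpos : 0 < P K := hPK ▸ tsub_pos_of_lt hδ
  have hKne : K.Nonempty := nonempty_of_measure_ne_zero hKpos.ne'
  rw [← hPK]
  let F : {V // V ∈ 𝒱 ∧ P Vᶜ < P K / ((d : ENNReal) + 1)} → Set (EuclideanSpace ℝ (Fin d)) :=
    fun V => V.1 ∩ K
  have hF : (⋂ i, F i).Nonempty := by
    refine Convex.helly_theorem_compact' (𝕜 := ℝ) (F := F)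
      (fun V => (h𝒱 _ V.2.1).2.inter hKconv) (fun V => hK.inter_left (h𝒱 _ V.2.1).1) fun I hI => ?_
    rcases I.eq_empty_or_nonempty with rfl | hIne
    · simp
    rw [finrank_euclideanSpace_fin] at hI
    by_contra hempty
    have hcover : K ⊆ ⋃ V ∈ I, (V.1)ᶜ := by
      intro x hx
      by_contra hxV
      refine hempty ⟨x, ?_⟩
      simp only [mem_iUnion, mem_compl_iff, not_exists, not_not] at hxV
      exact mem_iInter₂.2 fun V hV => ⟨hxV V hV, hx⟩
    refine lt_irrefl (P K) ?_
    calc P K ≤ P (⋃ V ∈ I, (V.1)ᶜ) := measure_mono hcover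
      _ ≤ ∑ V ∈ I, P (V.1)ᶜ := measure_biUnion_finset_le _ _
      _ < ∑ _V ∈ I, P K / ((d : ENNReal) + 1) :=
        ENNReal.sum_lt_sum_of_nonempty hIne fun V _ => V.2.2
      _ = (I.card : ENNReal) * (P K / ((d : ENNReal) + 1)) := by
        rw [Finset.sum_const, nsmul_eq_mul]
      _ ≤ ((d : ENNReal) + 1) * (P K / ((d : ENNReal) + 1)) := by
        gcongr
        exact_mod_cast hI
      _ = P K := ENNReal.mul_div_cancel (by simp) (by simp)
  obtain ⟨x, hxK, hx⟩ : ∃ x ∈ K, ∀ i, x ∈ F i := by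
    obtain ⟨x, hx⟩ := hF
    rw [mem_iInter] at hx
    by_cases hι : Nonempty {V // V ∈ 𝒱 ∧ P Vᶜ < P K / ((d : ENNReal) + 1)}
    · exact ⟨x, (hx hι.some).2, hx⟩
    · obtain ⟨y, hy⟩ := hKne
      exact ⟨y, hy, fun i => (hι ⟨i⟩).elim⟩
  refine ⟨x, hxK, le_sInf ?_⟩
  rintro _ ⟨U, hU, hxU, rfl⟩
  subst h𝒰
  obtain ⟨V, hV, rfl⟩ := hU
  by_contra hlt
  exact hxU (hx ⟨V, hV, not_le.1 hlt⟩).1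
end

section
/- Let P be a Borel probability measure on ℝ^d, let 𝒱 be a family of closed convex subsets of ℝ^d, let 𝒰 = {V^c : V ∈ 𝒱}, and assume conditions (C1) and (C2'') hold. Then condition (C2') also holds, and there exists a point x ∈ ℝ^d with D(x; P, 𝒰) ≥ 1/(d+1). -/
open MeasureTheory Set

/-- Finitely many sets, at most `k` of them, each missing mass less than `1 / k`, have a common
point. -/
theorem nonempty_sInter_of_measure_compl_lt {α : Type*} [MeasurableSpace α] (μ : Measure α)
    [IsProbabilityMeasure μ] {k : ℕ} (G : Finset (Set α)) (hcard : G.card ≤ k)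
    (hG : ∀ V ∈ G, μ Vᶜ < 1 / (k : ENNReal)) : (⋂₀ (G : Set (Set α))).Nonempty := by
  obtain rfl | hne := G.eq_empty_or_nonempty
  · have := nonempty_of_isProbabilityMeasure μ
    simp
  have hk : (k : ENNReal) ≠ 0 := by
    have := hne.card_pos
    exact_mod_cast (by omega : k ≠ 0)
  by_contra hempty
  have hcover : (univ : Set α) ⊆ ⋃ V ∈ G, Vᶜ := by
    intro x _
    by_contra hx
    exact hempty ⟨x, by simpa using hx⟩
  have : (1 : ENNReal) < 1 := calc
    1 = μ univ := measure_univ.symm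
    _ ≤ μ (⋃ V ∈ G, Vᶜ) := measure_mono hcover
    _ ≤ ∑ V ∈ G, μ Vᶜ := measure_biUnion_finset_le G _
    _ < ∑ _V ∈ G, 1 / (k : ENNReal) := ENNReal.sum_lt_sum_of_nonempty hne hG
    _ = G.card * (1 / (k : ENNReal)) := by simp
    _ ≤ k * (1 / (k : ENNReal)) := by gcongr
    _ = 1 := ENNReal.mul_div_cancel hk (ENNReal.natCast_ne_top k)
  exact this.false

/-- A centerpoint theorem: closed convex sets, each missing mass less than `1 / (dim E + 1)`,
have a common point. -/
theorem nonempty_sInter_of_convex_of_measure_compl_lt {E : Type*} [NormedAddCommGroup E]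
    [NormedSpace ℝ E] [FiniteDimensional ℝ E] [MeasurableSpace E] [BorelSpace E]
    (μ : Measure E) [IsProbabilityMeasure μ] (F : Set (Set E))
    (hclosed : ∀ V ∈ F, IsClosed V) (hconvex : ∀ V ∈ F, Convex ℝ V)
    (hF : ∀ V ∈ F, μ Vᶜ < 1 / ((Module.finrank ℝ E + 1 : ℕ) : ENNReal)) :
    (⋂₀ F).Nonempty := by
  classical
  have := FiniteDimensional.proper_real E
  obtain ⟨K, -, hK, hKμ⟩ := MeasurableSet.univ.exists_isCompact_sdiff_lt (measure_ne_top μ univ)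
    (show 1 / ((Module.finrank ℝ E + 1 : ℕ) : ENNReal) ≠ 0 by
      simp [ENNReal.add_eq_top])
  obtain ⟨r, hr⟩ := hK.isBounded.subset_closedBall (0 : E)
  have hball : μ (Metric.closedBall (0 : E) r)ᶜ
      < 1 / ((Module.finrank ℝ E + 1 : ℕ) : ENNReal) :=
    (measure_mono (by rw [compl_eq_univ_sdiff]; exact sdiff_subset_sdiff_right hr)).trans_lt hKμ
  have hfinite : ∀ u : Finset F,
      (Metric.closedBall (0 : E) r ∩ ⋂ V ∈ u, (V : Set E)).Nonempty := by
    intro u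
    have hmem : ∀ V ∈ insert (Metric.closedBall (0 : E) r) (u.image Subtype.val),
        V = Metric.closedBall (0 : E) r ∨ V ∈ F := by
      intro V hV
      obtain rfl | hV := Finset.mem_insert.1 hV
      · exact .inl rfl
      · obtain ⟨W, -, rfl⟩ := Finset.mem_image.1 hV
        exact .inr W.2
    obtain ⟨x, hx⟩ := Convex.helly_theorem_set' (𝕜 := ℝ)
      (F := insert (Metric.closedBall (0 : E) r) (u.image Subtype.val))
      (fun V hV ↦ by
        obtain rfl | hV := hmem V hV
        · exact convex_closedBall _ _
        · exact hconvex V hV)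
      (fun G hG hcard ↦ nonempty_sInter_of_measure_compl_lt μ G hcard fun V hV ↦ by
        obtain rfl | hV := hmem V (hG hV)
        · exact hball
        · exact hF V hV)
    refine ⟨x, hx _ (by simp), mem_iInter₂.2 fun V hV ↦ hx _ ?_⟩
    exact Finset.mem_coe.2 (Finset.mem_insert_of_mem (Finset.mem_image_of_mem _ hV))
  obtain ⟨x, -, hx⟩ := (isCompact_closedBall (0 : E) r).inter_iInter_nonempty
    (fun V : F ↦ (V : Set E)) (fun V ↦ hclosed V V.2) hfinite
  exact ⟨x, fun V hV ↦ mem_iInter.1 hx ⟨V, hV⟩⟩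


theorem exists_point_of_depth_ge_one_div_d_add_one {d : ℕ}
    (P : Measure (EuclideanSpace ℝ (Fin d))) [IsProbabilityMeasure P]
    (𝒱 : Set (Set (EuclideanSpace ℝ (Fin d))))
    (h𝒱 : ∀ V ∈ 𝒱, IsClosed V ∧ Convex ℝ V)
    (𝒰 : Set (Set (EuclideanSpace ℝ (Fin d)))) (h𝒰 : 𝒰 = compl '' 𝒱)
    (hC1 : ∀ x : EuclideanSpace ℝ (Fin d), ∃ U ∈ 𝒰, x ∈ U)
    (hC2'' : ∀ ε : ENNReal, 0 < ε → ∃ R : ℝ,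
        ∀ x : EuclideanSpace ℝ (Fin d), R < ‖x‖ → depth P 𝒰 x < ε) :
    (∃ x : EuclideanSpace ℝ (Fin d), 0 < depth P 𝒰 x) ∧
    ∃ x : EuclideanSpace ℝ (Fin d), 1 / ((d : ENNReal) + 1) ≤ depth P 𝒰 x := by
  obtain ⟨x, hx⟩ := nonempty_sInter_of_convex_of_measure_compl_lt P
    {V ∈ 𝒱 | P Vᶜ < 1 / ((d : ENNReal) + 1)} (fun V hV ↦ (h𝒱 V hV.1).1)
    (fun V hV ↦ (h𝒱 V hV.1).2) (fun V hV ↦ by simpa using hV.2)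
  have hdepth : 1 / ((d : ENNReal) + 1) ≤ depth P 𝒰 x := by
    refine le_sInf ?_
    rintro _ ⟨U, hU, hxU, rfl⟩
    rw [h𝒰] at hU
    obtain ⟨V, hV, rfl⟩ := hU
    by_contra! hlt
    exact hxU (hx V ⟨hV, hlt⟩)
  refine ⟨⟨x, lt_of_lt_of_le ?_ hdepth⟩, x, hdepth⟩
  exact ENNReal.div_pos one_ne_zero (by simp [ENNReal.add_eq_top])
end

section
/- Let 𝒱 be a family of compact convex subsets of ℝ^d, let 𝒰 = {V^c : V ∈ 𝒱}, assume condition (C1) holds, and suppose that for every closed ball B ⊆ ℝ^d there exists a set V ∈ 𝒱 with B ⊆ V. Then for every Borel probability measure P on ℝ^d, the depth function D(·; P, 𝒰) satisfies conditions (C2') and (C2''). -/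
open MeasureTheory Set

/-- If each member of a finite family of sets has a complement of probability less than `1 / n`,
and the family has at most `n` members, then these sets have a common point. -/
theorem sInter_nonempty_of_measure_compl_lt {Ω : Type*} [MeasurableSpace Ω] (P : Measure Ω)
    [IsProbabilityMeasure P] {n : ℕ} {G : Finset (Set Ω)}
    (hG : ∀ V ∈ G, P Vᶜ < (n : ENNReal)⁻¹) (hcard : G.card ≤ n) :
    (⋂₀ (G : Set (Set Ω))).Nonempty := by
  rcases G.eq_empty_or_nonempty with rfl | hne
  · have := P.nonempty_of_neZero
    simp
  by_contra hempty
  rw [not_nonempty_iff_eq_empty] at hempty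
  have hcover : ⋃ V ∈ G, Vᶜ = univ := by
    rw [← compl_empty, ← hempty, sInter_eq_biInter, compl_iInter₂]
    rfl
  have hlt : (1 : ENNReal) < 1 :=
    calc 1 = P (⋃ V ∈ G, Vᶜ) := by rw [hcover, measure_univ]
      _ ≤ ∑ V ∈ G, P Vᶜ := measure_biUnion_finset_le G _
      _ < ∑ _V ∈ G, (n : ENNReal)⁻¹ := ENNReal.sum_lt_sum_of_nonempty hne hG
      _ = G.card * (n : ENNReal)⁻¹ := by rw [Finset.sum_const, nsmul_eq_mul]
      _ ≤ n * (n : ENNReal)⁻¹ := by gcongr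
      _ ≤ 1 := ENNReal.mul_inv_le_one _
  exact hlt.false

/-- **Centerpoint theorem** for depth functions defined by complements of compact convex sets. -/
theorem exists_inv_le_depth {d : ℕ} {𝒱 : Set (Set (EuclideanSpace ℝ (Fin d)))}
    (h𝒱 : ∀ V ∈ 𝒱, IsCompact V ∧ Convex ℝ V)
    (P : Measure (EuclideanSpace ℝ (Fin d))) [IsProbabilityMeasure P] :
    ∃ x, ((d + 1 : ℕ) : ENNReal)⁻¹ ≤ depth P (compl '' 𝒱) x := by
  obtain ⟨x, hx⟩ := Convex.helly_theorem_set_compact' (𝕜 := ℝ)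
    (F := {V ∈ 𝒱 | P Vᶜ < ((d + 1 : ℕ) : ENNReal)⁻¹})
    (fun V hV ↦ (h𝒱 V hV.1).2) (fun V hV ↦ (h𝒱 V hV.1).1)
    (fun G hG hcard ↦ sInter_nonempty_of_measure_compl_lt P (fun V hV ↦ (hG hV).2)
      (by simpa using hcard))
  refine ⟨x, le_sInf ?_⟩
  rintro _ ⟨_, ⟨V, hV, rfl⟩, hxV, rfl⟩
  by_contra! hlt
  exact hxV (hx V ⟨hV, hlt⟩)

/-- Depth vanishes at infinity when bounded sets of `𝒱` contain arbitrarily large balls. -/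
theorem exists_depth_lt_of_norm_gt {d : ℕ} {𝒱 : Set (Set (EuclideanSpace ℝ (Fin d)))}
    (h𝒱 : ∀ V ∈ 𝒱, Bornology.IsBounded V)
    (hball : ∀ ρ : ℝ, ∃ V ∈ 𝒱, Metric.closedBall 0 ρ ⊆ V)
    (P : Measure (EuclideanSpace ℝ (Fin d))) [IsFiniteMeasure P] {ε : ENNReal} (hε : 0 < ε) :
    ∃ R : ℝ, ∀ x, R < ‖x‖ → depth P (compl '' 𝒱) x < ε := by
  have htendsto := tendsto_measure_compl_closedBall_of_isTightMeasureSet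
    (isTightMeasureSet_singleton (μ := P)) 0
  simp only [mem_singleton_iff, iSup_iSup_eq_left] at htendsto
  obtain ⟨ρ, hρ⟩ := (htendsto.eventually_lt_const hε).exists
  obtain ⟨V, hV, hρV⟩ := hball ρ
  obtain ⟨R, hR⟩ := (h𝒱 V hV).exists_norm_le
  refine ⟨R, fun x hx ↦ lt_of_le_of_lt ?_ hρ⟩
  calc depth P (compl '' 𝒱) x ≤ P Vᶜ :=
        sInf_le ⟨Vᶜ, mem_image_of_mem _ hV, fun hxV ↦ hx.not_ge (hR x hxV), rfl⟩
    _ ≤ P (Metric.closedBall 0 ρ)ᶜ := measure_mono (compl_subset_compl.2 hρV)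

theorem conditions_C2_of_compact_convex_family {d : ℕ}
    (𝒱 : Set (Set (EuclideanSpace ℝ (Fin d))))
    (h𝒱 : ∀ V ∈ 𝒱, IsCompact V ∧ Convex ℝ V)
    (𝒰 : Set (Set (EuclideanSpace ℝ (Fin d)))) (h𝒰 : 𝒰 = compl '' 𝒱)
    (hC1 : ∀ x : EuclideanSpace ℝ (Fin d), ∃ U ∈ 𝒰, x ∈ U)
    (hball : ∀ (c : EuclideanSpace ℝ (Fin d)) (ρ : ℝ), ∃ V ∈ 𝒱, Metric.closedBall c ρ ⊆ V)
    (P : Measure (EuclideanSpace ℝ (Fin d))) [IsProbabilityMeasure P] :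
    (∃ x : EuclideanSpace ℝ (Fin d), 0 < depth P 𝒰 x) ∧
    (∀ ε : ENNReal, 0 < ε → ∃ R : ℝ,
      ∀ x : EuclideanSpace ℝ (Fin d), R < ‖x‖ → depth P 𝒰 x < ε) := by
  subst h𝒰
  refine ⟨?_, fun ε hε ↦ exists_depth_lt_of_norm_gt (fun V hV ↦ (h𝒱 V hV).1.isBounded)
    (hball 0) P hε⟩
  obtain ⟨x, hx⟩ := exists_inv_le_depth h𝒱 P
  exact ⟨x, (ENNReal.inv_pos.2 (ENNReal.natCast_ne_top _)).trans_le hx⟩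
end

section
/- Let d ≥ 1, let ≼ be the coordinate-wise partial order on ℝ^d, and let P be a Borel probability measure on ℝ^d. Then for every x ∈ ℝ^d, the depth inf { P(J^c) : J a generalized interval with respect to ≼ with x ∉ J } equals the depth inf { P(H) : H a closed halfspace of the form {y : y_i ≤ t} or {y : y_i ≥ t} for some i ∈ {1,…,d}, t ∈ ℝ, with x ∈ H }; i.e., the depth function generated by coordinate-wise intervals coincides with the depth function generated by closed halfspaces whose boundaries are parallel to the coordinate hyperplanes. -/
open MeasureTheory Set

/-- If increasing measurable sets `J n` exhaust the complement of `H`, then a lower bound of the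
masses of their complements is a lower bound of the mass of `H`. -/
theorem le_measure_of_iUnion_eq_compl {α : Type*} [MeasurableSpace α] (μ : Measure α)
    [IsFiniteMeasure μ] {J : ℕ → Set α} {H : Set α} {c : ENNReal} (hJ : Monotone J)
    (hm : ∀ n, MeasurableSet (J n)) (hH : ⋃ n, J n = Hᶜ) (hc : ∀ n, c ≤ μ (J n)ᶜ) :
    c ≤ μ H := by
  have h := tendsto_measure_iInter_atTop (μ := μ) (s := fun n => (J n)ᶜ)
    (fun n => (hm n).compl.nullMeasurableSet)
    (fun _ _ hmn => compl_subset_compl.mpr (hJ hmn)) ⟨0, measure_ne_top _ _⟩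
  rw [← compl_iUnion, hH, compl_compl] at h
  exact ge_of_tendsto' h hc

theorem isClosed_setOf_coordLE_left {d : ℕ} (a : EuclideanSpace ℝ (Fin d)) :
    IsClosed {y | coordLE a y} := by
  simp only [coordLE, ofPred_forall]
  exact isClosed_iInter fun i => isClosed_le (by fun_prop) (by fun_prop)

theorem isClosed_setOf_coordLE_right {d : ℕ} (b : EuclideanSpace ℝ (Fin d)) :
    IsClosed {y | coordLE y b} := by
  simp only [coordLE, ofPred_forall]
  exact isClosed_iInter fun i => isClosed_le (by fun_prop) (by fun_prop)

/-- The point with `i`-th coordinate `t + 1 / (n + 1)` and all other coordinates `-n`. -/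
noncomputable def lowerCorner {d : ℕ} (i : Fin d) (t : ℝ) (n : ℕ) : EuclideanSpace ℝ (Fin d) :=
  WithLp.toLp 2 fun j => if j = i then t + 1 / ((n : ℝ) + 1) else -(n : ℝ)

theorem lowerCorner_apply {d : ℕ} (i j : Fin d) (t : ℝ) (n : ℕ) :
    lowerCorner i t n j = if j = i then t + 1 / ((n : ℝ) + 1) else -(n : ℝ) := rfl

theorem lt_lowerCorner_self {d : ℕ} (i : Fin d) (t : ℝ) (n : ℕ) : t < lowerCorner i t n i := by
  rw [lowerCorner_apply, if_pos rfl]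
  have : 0 < 1 / ((n : ℝ) + 1) := by positivity
  linarith

theorem lowerCorner_antitone {d : ℕ} (i : Fin d) (t : ℝ) {m n : ℕ} (h : m ≤ n) :
    coordLE (lowerCorner i t n) (lowerCorner i t m) := by
  intro j
  simp only [lowerCorner_apply]
  split_ifs
  · gcongr
  · gcongr

theorem exists_lowerCorner_coordLE {d : ℕ} {i : Fin d} {t : ℝ} {y : EuclideanSpace ℝ (Fin d)}
    (h : t < y i) : ∃ n, coordLE (lowerCorner i t n) y := by
  obtain ⟨k, hk⟩ := exists_nat_one_div_lt (sub_pos.mpr h)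
  obtain ⟨m, hm⟩ := exists_nat_ge ‖y‖
  refine ⟨max k m, fun j => ?_⟩
  rw [lowerCorner_apply]
  split_ifs with hj
  · subst hj
    have : 1 / (((max k m : ℕ) : ℝ) + 1) ≤ 1 / ((k : ℝ) + 1) := by
      gcongr
      exact le_max_left k m
    linarith
  · have hy : |y j| ≤ ‖y‖ := PiLp.norm_apply_le y j
    have hmax : (m : ℝ) ≤ (max k m : ℕ) := by exact_mod_cast le_max_right k m
    linarith [neg_abs_le (y j)]

theorem iUnion_setOf_lowerCorner_coordLE {d : ℕ} (i : Fin d) (t : ℝ) :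
    ⋃ n, {y | coordLE (lowerCorner i t n) y} =
      {y : EuclideanSpace ℝ (Fin d) | y i ≤ t}ᶜ := by
  ext y
  simp only [mem_iUnion, mem_ofPred_eq, mem_compl_iff, not_le]
  exact ⟨fun ⟨n, hn⟩ => (lt_lowerCorner_self i t n).trans_le (hn i), exists_lowerCorner_coordLE⟩

theorem iUnion_setOf_coordLE_neg_lowerCorner {d : ℕ} (i : Fin d) (t : ℝ) :
    ⋃ n, {y | coordLE y (-lowerCorner i (-t) n)} =
      {y : EuclideanSpace ℝ (Fin d) | t ≤ y i}ᶜ := by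
  ext y
  have h := Set.ext_iff.mp (iUnion_setOf_lowerCorner_coordLE i (-t)) (-y)
  simpa [coordLE, le_neg] using h

theorem interval_depth_eq_axis_parallel_halfspace_depth {d : ℕ} (hd : 1 ≤ d)
    (P : Measure (EuclideanSpace ℝ (Fin d))) [IsProbabilityMeasure P]
    (x : EuclideanSpace ℝ (Fin d)) :
    sInf {p | ∃ J : Set (EuclideanSpace ℝ (Fin d)),
        IsGenInterval (coordLE (d := d)) J ∧ x ∉ J ∧ P Jᶜ = p} =
    sInf {p | ∃ (i : Fin d) (t : ℝ),
        (x i ≤ t ∧ P {y : EuclideanSpace ℝ (Fin d) | y i ≤ t} = p) ∨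
        (t ≤ x i ∧ P {y : EuclideanSpace ℝ (Fin d) | t ≤ y i} = p)} := by
  apply le_antisymm
  · refine le_sInf ?_
    rintro p ⟨i, t, ⟨hx, rfl⟩ | ⟨hx, rfl⟩⟩
    · refine le_measure_of_iUnion_eq_compl P (J := fun n => {y | coordLE (lowerCorner i t n) y})
        (fun m n hmn y hy j => (lowerCorner_antitone i t hmn j).trans (hy j))
        (fun n => (isClosed_setOf_coordLE_left _).measurableSet)
        (iUnion_setOf_lowerCorner_coordLE i t) fun n => sInf_le ⟨_, ?_, ?_, rfl⟩
      · exact Or.inr (Or.inl ⟨_, rfl⟩)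
      · exact fun h => ((lt_lowerCorner_self i t n).trans_le (h i)).not_ge hx
    · refine le_measure_of_iUnion_eq_compl P (J := fun n => {y | coordLE y (-lowerCorner i (-t) n)})
        (fun m n hmn y hy j => (hy j).trans (neg_le_neg (lowerCorner_antitone i (-t) hmn j)))
        (fun n => (isClosed_setOf_coordLE_right _).measurableSet)
        (iUnion_setOf_coordLE_neg_lowerCorner i t) fun n => sInf_le ⟨_, ?_, ?_, rfl⟩
      · exact Or.inr (Or.inr (Or.inl ⟨_, rfl⟩))
      · intro h
        have hi : x i ≤ -lowerCorner i (-t) n i := h i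
        linarith [lt_lowerCorner_self i (-t) n]
  · refine le_sInf ?_
    rintro p ⟨J, hJ, hxJ, rfl⟩
    have left {a : EuclideanSpace ℝ (Fin d)} (ha : ¬ coordLE a x) (hsub : ∀ y ∈ J, coordLE a y) :
        ∃ i, {y : EuclideanSpace ℝ (Fin d) | y i ≤ x i} ⊆ Jᶜ := by
      obtain ⟨i, hi⟩ := not_forall.mp ha
      exact ⟨i, fun y hy hyJ => hi ((hsub y hyJ i).trans hy)⟩
    have right {b : EuclideanSpace ℝ (Fin d)} (hb : ¬ coordLE x b) (hsub : ∀ y ∈ J, coordLE y b) :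
        ∃ i, {y : EuclideanSpace ℝ (Fin d) | x i ≤ y i} ⊆ Jᶜ := by
      obtain ⟨i, hi⟩ := not_forall.mp hb
      exact ⟨i, fun y hy hyJ => hi (le_trans hy (hsub y hyJ i))⟩
    have key : (∃ i, {y : EuclideanSpace ℝ (Fin d) | y i ≤ x i} ⊆ Jᶜ) ∨
        ∃ i, {y : EuclideanSpace ℝ (Fin d) | x i ≤ y i} ⊆ Jᶜ := by
      rcases hJ with ⟨a, b, rfl⟩ | ⟨a, rfl⟩ | ⟨b, rfl⟩ | rfl
      · rcases not_and_or.mp hxJ with h | h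
        · exact Or.inl (left h fun y hy => hy.1)
        · exact Or.inr (right h fun y hy => hy.2)
      · exact Or.inl (left hxJ fun y hy => hy)
      · exact Or.inr (right hxJ fun y hy => hy)
      · exact absurd (mem_univ x) hxJ
    rcases key with ⟨i, hi⟩ | ⟨i, hi⟩
    · exact sInf_le_of_le ⟨i, x i, Or.inl ⟨le_rfl, rfl⟩⟩ (measure_mono hi)
    · exact sInf_le_of_le ⟨i, x i, Or.inr ⟨le_rfl, rfl⟩⟩ (measure_mono hi)
end

section
/- Let ≼ be a partial order on ℝ^d satisfying conditions (I1), (I2) and (I3), let 𝒱 be the family of all generalized intervals with respect to ≼, let X be a random vector in ℝ^d with distribution P, and let {Med X} be the median set of P with respect to ≼. Let f : ℝ^d → ℝ be a C-function with respect to 𝒱. Then for every median M of f(X) (i.e., every M ∈ ℝ with P({x : f(x) ≤ M}) ≥ 1/2 and P({x : f(x) ≥ M}) ≥ 1/2), there exists m ∈ {Med X} such that f(m) ≤ M. -/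
open MeasureTheory Set

/-- Helly property: pairwise intersecting generalized intervals have a common point, provided
one of them is order bounded. -/
theorem exists_mem_sInter_of_pairwise_inter {E : Type*} {r : E → E → Prop} [IsTrans E r]
    (hI3 : CondI3 r) {F : Set (Set E)} (hF : ∀ J ∈ F, IsGenInterval r J)
    (hinter : ∀ J ∈ F, ∀ K ∈ F, (J ∩ K).Nonempty)
    (hbdd : ∃ a b : E, {x | r a x ∧ r x b} ∈ F) : ∃ m, m ∈ ⋂₀ F := by
  obtain ⟨a₀, b₀, h₀⟩ := hbdd
  let A : Set E := {a | ∃ J ∈ F, ∀ x ∈ J, r a x}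
  have hAB : ∀ a ∈ A, ∀ K ∈ F, ∀ b, (∀ x ∈ K, r x b) → r a b := by
    rintro a ⟨J, hJ, ha⟩ K hK b hb
    obtain ⟨x, hxJ, hxK⟩ := hinter J hJ K hK
    exact trans_of r (ha x hxJ) (hb x hxK)
  obtain ⟨m, hm, hm'⟩ := hI3.1 A ⟨a₀, _, h₀, fun x hx => hx.1⟩
    ⟨b₀, fun a ha => hAB a ha _ h₀ b₀ fun x hx => hx.2⟩
  refine ⟨m, fun J hJ => ?_⟩
  have lower : ∀ a, (∀ x ∈ J, r a x) → r a m := fun a ha => hm a ⟨J, hJ, ha⟩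
  have upper : ∀ b, (∀ x ∈ J, r x b) → r m b := fun b hb => hm' b fun a ha => hAB a ha J hJ b hb
  rcases hF J hJ with ⟨a, b, rfl⟩ | ⟨a, rfl⟩ | ⟨b, rfl⟩ | rfl
  · exact ⟨lower a fun x hx => hx.1, upper b fun x hx => hx.2⟩
  · exact lower a fun x hx => hx
  · exact upper b fun x hx => hx
  · exact mem_univ m

theorem IsGenInterval.isClosed {E : Type*} [TopologicalSpace E] {r : E → E → Prop}
    (hI1 : CondI1 r) {J : Set E} (hJ : IsGenInterval r J) : IsClosed J := by
  rcases hJ with ⟨a, b, rfl⟩ | ⟨a, rfl⟩ | ⟨b, rfl⟩ | rfl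
  · exact (hI1.1 a).inter (hI1.2.1 b)
  · exact hI1.1 a
  · exact hI1.2.1 b
  · exact isClosed_univ

theorem exists_lt_measure_interval {E : Type*} [PseudoMetricSpace E] [Nonempty E]
    [MeasurableSpace E] {r : E → E → Prop} (hI2 : CondI2 r) (P : Measure E)
    {c : ENNReal} (hc : c < P univ) : ∃ a b : E, c < P {x | r a x ∧ r x b} := by
  obtain ⟨x₀⟩ := ‹Nonempty E›
  have hmono : Monotone fun n : ℕ => Metric.closedBall x₀ (n : ℝ) := fun m n hmn =>
    Metric.closedBall_subset_closedBall (by exact_mod_cast hmn)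
  have hlim := tendsto_measure_iUnion_atTop (μ := P) hmono
  rw [Metric.iUnion_closedBall_nat] at hlim
  obtain ⟨n, hn⟩ := (hlim.eventually (lt_mem_nhds hc)).exists
  obtain ⟨a, b, hab⟩ := hI2 x₀ n
  exact ⟨a, b, hn.trans_le (measure_mono hab)⟩

theorem jensen_inequality_for_medians {d : ℕ}
    (r : EuclideanSpace ℝ (Fin d) → EuclideanSpace ℝ (Fin d) → Prop)
    (hr : IsPartialOrder (EuclideanSpace ℝ (Fin d)) r)
    (hI1 : CondI1 r) (hI2 : CondI2 r) (hI3 : CondI3 r)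
    (P : Measure (EuclideanSpace ℝ (Fin d))) [IsProbabilityMeasure P]
    (f : EuclideanSpace ℝ (Fin d) → ℝ)
    (hf : ∀ t : ℝ, {x | f x ≤ t} = ∅ ∨ IsGenInterval r {x | f x ≤ t}) :
    ∀ M : ℝ, 1/2 ≤ P {x | f x ≤ M} → 1/2 ≤ P {x | M ≤ f x} →
      ∃ m ∈ ⋂₀ {J | IsGenInterval r J ∧ 1/2 < P J}, f m ≤ M := by
  intro M hM _
  have hhalf : (1 / 2 : ENNReal) < 1 := by
    rw [one_div]; exact ENNReal.one_half_lt_one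
  have hK : IsGenInterval r {x | f x ≤ M} := by
    refine (hf M).resolve_left fun h => ?_
    rw [h, measure_empty] at hM
    simp at hM
  have hinter : ∀ J K : Set (EuclideanSpace ℝ (Fin d)), IsGenInterval r K →
      1 / 2 < P J → 1 / 2 ≤ P K → (J ∩ K).Nonempty := by
    intro J K hK hJP hKP
    refine nonempty_inter_of_measure_lt_add P (hK.isClosed hI1).measurableSet
      (subset_univ J) (subset_univ K) ?_
    rw [measure_univ, ← ENNReal.add_halves 1]
    exact ENNReal.add_lt_add_of_lt_of_le (hhalf.trans ENNReal.one_lt_top).ne hJP hKP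
  have hKne : {x | f x ≤ M}.Nonempty := by
    simpa using hinter univ _ hK (by simp) hM
  obtain ⟨a, b, hab⟩ := exists_lt_measure_interval hI2 P (c := 1 / 2) (by simp)
  have hF : ∀ J ∈ insert {x | f x ≤ M} {J | IsGenInterval r J ∧ 1 / 2 < P J},
      IsGenInterval r J := by
    rintro J (rfl | hJ)
    exacts [hK, hJ.1]
  obtain ⟨m, hm⟩ := exists_mem_sInter_of_pairwise_inter hI3 hF (by
    rintro J (rfl | hJ) L (rfl | hL)
    · simpa using hKne
    · rw [inter_comm]
      exact hinter _ _ hK hL.2 hM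
    · exact hinter _ _ hK hJ.2 hM
    · exact hinter _ _ hL.1 hJ.2 hL.2.le)
    ⟨a, b, Or.inr ⟨Or.inl ⟨a, b, rfl⟩, hab⟩⟩
  rw [sInter_insert] at hm
  exact ⟨m, hm.2, hm.1⟩
end

section
/- Let 𝒱 be a family of closed subsets of ℝ^d, let 𝒰 = {V^c : V ∈ 𝒱}, let P be a Borel probability measure on ℝ^d, and assume conditions (C1), (C2') and (C2'') hold, so that D(·;P,𝒰) attains its maximum value α_m on the nonempty set C(P,𝒰) = {x : D(x;P,𝒰) = α_m}. Let f : ℝ^d → ℝ be a C-function with respect to 𝒱. Then for every m ∈ C(P,𝒰), f(m) ≤ Q_{1−α_m}, where Q_{1−α_m} = sup { t ∈ ℝ : P({x : f(x) ≥ t}) ≥ α_m } is the largest quantile of order 1 − α_m of f under P. -/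
open MeasureTheory Set

theorem depth_le_measure {d : ℕ} {P : Measure (EuclideanSpace ℝ (Fin d))}
    {𝒰 : Set (Set (EuclideanSpace ℝ (Fin d)))} {x : EuclideanSpace ℝ (Fin d)}
    {U : Set (EuclideanSpace ℝ (Fin d))} (hU : U ∈ 𝒰) (hx : x ∈ U) :
    depth P 𝒰 x ≤ P U :=
  sInf_le ⟨U, hU, hx, rfl⟩

/-- The upper tails of a real measurable function have arbitrarily small mass, so the levels
whose tail has mass at least `a > 0` are bounded above. -/
theorem bddAbove_setOf_le_measure_superlevel {α : Type*} [MeasurableSpace α] {μ : Measure α}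
    [IsFiniteMeasure μ] {f : α → ℝ} (hf : Measurable f) {a : ENNReal} (ha : 0 < a) :
    BddAbove {t : ℝ | a ≤ μ {x | t ≤ f x}} := by
  have hlim : Filter.Tendsto (fun n : ℕ => μ {x | (n : ℝ) ≤ f x}) Filter.atTop (nhds 0) := by
    have hempty : ⋂ n : ℕ, {x | (n : ℝ) ≤ f x} = ∅ := by
      refine eq_empty_of_forall_notMem fun x hx => ?_
      obtain ⟨n, hn⟩ := exists_nat_gt (f x)
      exact hn.not_ge (mem_iInter.1 hx n)
    have := tendsto_measure_iInter_atTop (μ := μ) (s := fun n : ℕ => {x | (n : ℝ) ≤ f x})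
      (fun n => (measurableSet_le measurable_const hf).nullMeasurableSet)
      (fun m n hmn x (hx : (n : ℝ) ≤ f x) => mem_ofPred.2 ((Nat.cast_le.2 hmn).trans hx))
      ⟨0, measure_ne_top _ _⟩
    rwa [hempty, measure_empty] at this
  obtain ⟨n, hn⟩ := (hlim.eventually_lt_const ha).exists
  refine ⟨n, fun t ht => le_of_not_gt fun hnt => ?_⟩
  exact (ht.trans (measure_mono fun x hx => hnt.le.trans hx)).not_gt hn

theorem jensen_inequality_for_depth_centers {d : ℕ}
    (𝒱 : Set (Set (EuclideanSpace ℝ (Fin d)))) (h𝒱 : ∀ V ∈ 𝒱, IsClosed V)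
    (𝒰 : Set (Set (EuclideanSpace ℝ (Fin d)))) (h𝒰 : 𝒰 = compl '' 𝒱)
    (P : Measure (EuclideanSpace ℝ (Fin d))) [IsProbabilityMeasure P]
    (hC1 : ∀ x : EuclideanSpace ℝ (Fin d), ∃ U ∈ 𝒰, x ∈ U)
    (hC2' : ∃ x : EuclideanSpace ℝ (Fin d), 0 < depth P 𝒰 x)
    (hC2'' : ∀ ε : ENNReal, 0 < ε → ∃ R : ℝ,
        ∀ x : EuclideanSpace ℝ (Fin d), R < ‖x‖ → depth P 𝒰 x < ε)
    (αm : ENNReal) (hαm : IsGreatest (Set.range (depth P 𝒰)) αm)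
    (f : EuclideanSpace ℝ (Fin d) → ℝ)
    (hf : ∀ t : ℝ, {x | f x ≤ t} = ∅ ∨ {x | f x ≤ t} ∈ 𝒱) :
    ∀ m : EuclideanSpace ℝ (Fin d), depth P 𝒰 m = αm →
      f m ≤ sSup {t : ℝ | αm ≤ P {x | t ≤ f x}} := by
  intro m hm
  have hmeas : Measurable f := measurable_of_Iic fun t => by
    change MeasurableSet {x | f x ≤ t}
    rcases hf t with h | h
    · exact h ▸ MeasurableSet.empty
    · exact (h𝒱 _ h).measurableSet
  have hpos : 0 < αm := by
    obtain ⟨x, hx⟩ := hC2'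
    exact hx.trans_le (hαm.2 ⟨x, rfl⟩)
  refine le_of_forall_lt fun s hs => ?_
  obtain ⟨t, hst, htm⟩ := exists_between hs
  refine hst.trans_le (le_csSup (bddAbove_setOf_le_measure_superlevel hmeas hpos) ?_)
  rw [mem_ofPred_eq, ← hm]
  rcases hf t with h | h
  · obtain ⟨U, hU, hmU⟩ := hC1 m
    refine (depth_le_measure hU hmU).trans (measure_mono fun x _ => ?_)
    exact le_of_not_ge (α := ℝ) fun hx => eq_empty_iff_forall_notMem.1 h x hx
  · have hU : {x | f x ≤ t}ᶜ ∈ 𝒰 := h𝒰 ▸ mem_image_of_mem _ h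
    refine (depth_le_measure hU (not_le.2 htm)).trans (measure_mono fun x hx => ?_)
    exact (lt_of_not_ge (α := ℝ) hx).le
end
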